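/- MacWilliams Extension Theorem for Laurent-series convolutional codes: let R = F((z)) and let C, C̄ ⊆ R^n be k-dimensional R-codes. Then every R-isometry φ : C → C̄ extends to an R-isometry of R^n; more precisely, there exists a z-monomial matrix M over R such that φ(v) = vM for all v ∈ C. -/

import Mathlib

open Matrix Polynomial

variable {F : Type*} [Field F]

/-- A polynomial matrix is basic if its evaluation at every point of the algebraic
closure has full row rank. -/
def IsBasic {k n : ℕ} (G : Matrix (Fin k) (Fin n) (Polynomial F)) : Prop :=
  ∀ lam : AlgebraicClosure F, (G.map fun p => (Polynomial.aeval lam) p).rank = k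

/-- The weight of a Laurent series row vector. -/
noncomputable def wtL {n : ℕ} (v : Fin n → LaurentSeries F) : ℕ∞ :=
  ∑ i, ((v i).support).encard

/-- The Laurent series code generated by a polynomial encoder `G`. -/
def codeOfLS {k n : ℕ} (G : Matrix (Fin k) (Fin n) (Polynomial F)) :
    Set (Fin n → LaurentSeries F) :=
  Set.range fun u : Fin k → LaurentSeries F =>
    u ᵥ* (G.map fun p => algebraMap (Polynomial F) (LaurentSeries F) p)

/-- A `k`-dimensional code over the Laurent series field. -/
def IsLSCode {n : ℕ} (k : ℕ) (C : Submodule (LaurentSeries F) (Fin n → LaurentSeries F)) :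
    Prop :=
  ∃ G : Matrix (Fin k) (Fin n) (Polynomial F),
    IsBasic G ∧ (C : Set (Fin n → LaurentSeries F)) = codeOfLS G

/-- A `z`-monomial matrix over the Laurent series field. -/
def IsZMonomialLS {n : ℕ} (M : Matrix (Fin n) (Fin n) (LaurentSeries F)) : Prop :=
  ∃ (σ : Equiv.Perm (Fin n)) (α : Fin n → Fˣ) (μ : Fin n → ℤ),
    ∀ i j, M i j = if σ i = j then HahnSeries.single (μ j) (α j : F) else 0

/-- Over a finite field, two finite families of functionals with the same number of nonzero values
at every vector have the same number of members proportional to a given nonzero functional. -/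
theorem card_smul_eq_of_card_ne_zero_eq {F V ι : Type*} [Field F] [Finite F] [AddCommGroup V]
    [Module F V] [Fintype ι] (f h : ι → V →ₗ[F] F)
    (hfh : ∀ v, {i | f i v ≠ 0}.ncard = {i | h i v ≠ 0}.ncard) {ψ : V →ₗ[F] F} (hψ : ψ ≠ 0) :
    {i | ∃ a : F, a • f i = ψ}.ncard = {i | ∃ a : F, a • h i = ψ}.ncard := by
  classical
  have := Fintype.ofFinite F
  let χ := AddChar.FiniteField.primitiveChar_to_Complex F
  have hχ : χ.IsPrimitive := AddChar.FiniteField.primitiveChar_to_Complex_isPrimitive F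
  let E : (V →ₗ[F] F) → (Multiplicative V →* ℂ) := fun g =>
    { toFun := fun v => χ (g v.toAdd)
      map_one' := by simp
      map_mul' := fun v w => by simp [AddChar.map_add_eq_mul] }
  have E_inj : Function.Injective E := by
    intro g g' hgg
    ext v
    refine AddChar.to_mulShift_inj_of_isPrimitive hχ ?_
    ext c
    have := DFunLike.congr_fun hgg (Multiplicative.ofAdd (c • v))
    simpa [E, AddChar.mulShift_apply, mul_comm] using this
  let S : (ι → V →ₗ[F] F) → ((Multiplicative V →* ℂ) →₀ ℂ) := fun f =>
    ∑ i, ∑ a : F, Finsupp.single (E (a • f i)) 1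
  have hS (f : ι → V →ₗ[F] F) (v : V) :
      (Finsupp.linearCombination ℂ (fun g : Multiplicative V →* ℂ => (g : Multiplicative V → ℂ))
        (S f)) (Multiplicative.ofAdd v) =
        Fintype.card F * (Fintype.card ι - {i | f i v ≠ 0}.ncard : ℂ) := by
    have h1 : ∀ i, ∑ a : F, χ (a * f i v) = if f i v = 0 then (Fintype.card F : ℂ) else 0 :=
      fun i => by simpa using AddChar.sum_mulShift (f i v) hχ
    have h2 : ((Finset.univ.filter fun i => f i v = 0).card : ℂ) +
        (Finset.univ.filter fun i => ¬ f i v = 0).card = Fintype.card ι := by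
      exact_mod_cast Finset.card_filter_add_card_filter_not (s := Finset.univ) fun i => f i v = 0
    have h3 : {i | f i v ≠ 0}.ncard = (Finset.univ.filter fun i => ¬ f i v = 0).card := by
      rw [← Set.ncard_coe_finset]; simp
    simp only [S, map_sum, Finsupp.linearCombination_single, one_smul, Finset.sum_apply]
    simp only [E, MonoidHom.coe_mk, OneHom.coe_mk, toAdd_ofAdd, LinearMap.smul_apply, smul_eq_mul,
      h1]
    rw [h3, ← h2, Finset.sum_ite]
    simp [mul_comm]
  have hS_eq : S f = S h := by
    refine linearIndependent_monoidHom (Multiplicative V) ℂ ?_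
    funext v
    rw [← ofAdd_toAdd v, hS, hS, hfh]
  have count (f : ι → V →ₗ[F] F) : S f (E ψ) = {i | ∃ a : F, a • f i = ψ}.ncard := by
    have h1 (i : ι) : ∑ a : F, (if a • f i = ψ then (1 : ℂ) else 0) =
        if ∃ a : F, a • f i = ψ then 1 else 0 := by
      split_ifs with hi
      · obtain ⟨a, ha⟩ := hi
        rw [Finset.sum_eq_single a _ (by simp), if_pos ha]
        intro b _ hba
        refine if_neg fun hb => hba (smul_left_injective F (?_ : f i ≠ 0) (hb.trans ha.symm))
        rintro h0
        exact hψ (by rw [← ha, h0, smul_zero])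
      · exact Finset.sum_eq_zero fun a _ => if_neg fun ha => hi ⟨a, ha⟩
    simp only [S, Finsupp.finsetSum_apply, Finsupp.single_apply, E_inj.eq_iff, h1]
    rw [Finset.sum_boole, ← Set.ncard_coe_finset]
    simp
  exact_mod_cast (count f).symm.trans ((DFunLike.congr_fun hS_eq _).trans (count h))

/-- The version of `card_smul_eq_of_card_ne_zero_eq` for infinite families of functionals of which
only finitely many are nonzero at each vector. -/
theorem encard_smul_eq_of_encard_ne_zero_eq {F U ι : Type*} [Field F] [Finite F] [AddCommGroup U]
    [Module F U] (f h : ι → U →ₗ[F] F) (hf : ∀ u, {i | f i u ≠ 0}.Finite)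
    (hfh : ∀ u, {i | f i u ≠ 0}.encard = {i | h i u ≠ 0}.encard) {ψ : U →ₗ[F] F} (hψ : ψ ≠ 0) :
    {i | ∃ a : F, a • f i = ψ}.encard = {i | ∃ a : F, a • h i = ψ}.encard := by
  classical
  have := Fintype.ofFinite F
  have hh (u) : {i | h i u ≠ 0}.Finite := by
    rw [← Set.encard_lt_top_iff, ← hfh, Set.encard_lt_top_iff]; exact hf u
  have hw (g : U →ₗ[F] F) : ∃ u, g u = 0 → g = 0 := by
    by_cases hg : g = 0
    · exact ⟨0, fun _ => hg⟩
    · obtain ⟨u, hu⟩ := DFunLike.ne_iff.1 hg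
      exact ⟨u, fun h => absurd h hu⟩
  choose w hw using hw
  let T₀ : Finset ι := (hf (w ψ)).toFinset ∪ (hh (w ψ)).toFinset
  let S : Finset U := insert (w ψ) ((T₀ ×ˢ Finset.univ).image (fun p : ι × F => w (p.2 • f p.1 - ψ))
    ∪ (T₀ ×ˢ Finset.univ).image (fun p : ι × F => w (p.2 • h p.1 - ψ)))
  let T : Finset ι := S.biUnion fun s => (hf s).toFinset ∪ (hh s).toFinset
  let V := Submodule.span F (S : Set U)
  have hψw : ψ (w ψ) ≠ 0 := fun h0 => hψ (hw ψ h0)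
  have hwS : w ψ ∈ S := Finset.mem_insert_self _ _
  have hSV {s} (hs : s ∈ S) : s ∈ V := Submodule.subset_span hs
  have restrict (f : ι → U →ₗ[F] F) (hT : ∀ i ∉ T, ∀ s ∈ S, f i s = 0)
      (hS : ∀ i (a : F), f i (w ψ) ≠ 0 → w (a • f i - ψ) ∈ S) :
      {i | ∃ a : F, a • f i = ψ}.encard =
        {i : T | ∃ a : F, a • (f i).domRestrict V = ψ.domRestrict V}.ncard := by
    rw [(Set.toFinite _).cast_ncard_eq, ← Subtype.val_injective.encard_image]
    congr 1
    ext i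
    constructor
    · rintro ⟨a, ha⟩
      have hi : i ∈ T := by
        by_contra hi
        apply hψw
        have h0 := LinearMap.congr_fun ha (w ψ)
        rw [← h0, LinearMap.smul_apply, hT i hi _ hwS, smul_zero]
      exact ⟨⟨i, hi⟩, ⟨a, by rw [← ha]; rfl⟩, rfl⟩
    · rintro ⟨⟨i, hi⟩, ⟨a, ha⟩, rfl⟩
      have ha' {s} (hs : s ∈ S) : a * f i s = ψ s := DFunLike.congr_fun ha ⟨s, hSV hs⟩
      refine ⟨a, sub_eq_zero.1 (hw _ ?_)⟩
      have hne : f i (w ψ) ≠ 0 := by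
        intro h0
        apply hψw
        rw [← ha' hwS, h0, mul_zero]
      simp [ha' (hS i a hne)]
  have weight (f : ι → U →ₗ[F] F) (hT : ∀ i ∉ T, ∀ s ∈ S, f i s = 0) (v : V) :
      {i | f i v ≠ 0}.encard = {i : T | (f i).domRestrict V v ≠ 0}.ncard := by
    rw [(Set.toFinite _).cast_ncard_eq, ← Subtype.val_injective.encard_image]
    congr 1
    ext i
    constructor
    · intro hi
      refine ⟨⟨i, by_contra fun hiT => hi ?_⟩, hi, rfl⟩
      exact (Submodule.span_le (p := LinearMap.ker (f i))).2 (hT i hiT) v.2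
    · rintro ⟨i, hi, rfl⟩
      exact hi
  have hTf : ∀ i ∉ T, ∀ s ∈ S, f i s = 0 := by
    intro i hi s hs
    by_contra h0
    exact hi (Finset.mem_biUnion.2 ⟨s, hs, by simp [h0]⟩)
  have hTh : ∀ i ∉ T, ∀ s ∈ S, h i s = 0 := by
    intro i hi s hs
    by_contra h0
    exact hi (Finset.mem_biUnion.2 ⟨s, hs, by simp [h0]⟩)
  have hSf : ∀ i (a : F), f i (w ψ) ≠ 0 → w (a • f i - ψ) ∈ S := fun i a hi =>
    Finset.mem_insert_of_mem (Finset.mem_union_left _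
      (Finset.mem_image.2 ⟨(i, a), by simp [T₀, hi], rfl⟩))
  have hSh : ∀ i (a : F), h i (w ψ) ≠ 0 → w (a • h i - ψ) ∈ S := fun i a hi =>
    Finset.mem_insert_of_mem (Finset.mem_union_right _
      (Finset.mem_image.2 ⟨(i, a), by simp [T₀, hi], rfl⟩))
  rw [restrict f hTf hSf, restrict h hTh hSh]
  congr 1
  refine card_smul_eq_of_card_ne_zero_eq _ _ (fun v => ?_) fun h0 =>
    hψw (DFunLike.congr_fun h0 ⟨w ψ, hSV hwS⟩)
  have := hfh v
  rw [weight f hTf, weight h hTh] at this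
  exact_mod_cast this

instance LaurentSeries.isScalarTower_coeff_self (F : Type*) [Field F] :
    IsScalarTower F (LaurentSeries F) (LaurentSeries F) where
  smul_assoc a x y := by
    rw [smul_eq_mul, smul_eq_mul, ← HahnSeries.single_zero_mul_eq_smul, mul_assoc,
      HahnSeries.single_zero_mul_eq_smul]

/-- The `F`-linear functional reading off the coefficient of `z ^ t` of an `R`-linear functional. -/
noncomputable def coeffFunctional {F M : Type*} [Field F] [AddCommGroup M]
    [Module (LaurentSeries F) M] [Module F M] [IsScalarTower F (LaurentSeries F) M]
    (U : Submodule F M) (c : M →ₗ[LaurentSeries F] LaurentSeries F) (t : ℤ) : U →ₗ[F] F :=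
  HahnSeries.coeff.linearMap t ∘ₗ c.restrictScalars F ∘ₗ U.subtype

section Functionals

variable {F M : Type*} [Field F] [AddCommGroup M] [Module (LaurentSeries F) M] [Module F M]
  [IsScalarTower F (LaurentSeries F) M] {U : Submodule F M}

theorem coeffFunctional_apply (c : M →ₗ[LaurentSeries F] LaurentSeries F) (t : ℤ) (u : U) :
    coeffFunctional U c t u = (c u).coeff t := rfl

/-- On a spanning shift-invariant subspace, proportionality of two coefficient functionals means
proportionality of the underlying functionals by a monomial. -/
theorem smul_coeffFunctional_eq_iff (hU : Submodule.span (LaurentSeries F) (U : Set M) = ⊤)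
    (hshift : ∀ u ∈ U, ∀ s : ℤ, (HahnSeries.single s (1 : F) : LaurentSeries F) • u ∈ U)
    (c g : M →ₗ[LaurentSeries F] LaurentSeries F) (a : F) (t : ℤ) :
    a • coeffFunctional U c t = coeffFunctional U g 0 ↔
      g = (HahnSeries.single (-t) a : LaurentSeries F) • c := by
  constructor
  · intro h
    refine LinearMap.ext_on hU fun u hu => HahnSeries.ext (funext fun s => ?_)
    have := DFunLike.congr_fun h ⟨_, hshift u hu (-s)⟩
    simp only [LinearMap.smul_apply, coeffFunctional_apply, map_smul, smul_eq_mul,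
      HahnSeries.coeff_single_mul, one_mul, sub_neg_eq_add, zero_add] at this ⊢
    rw [← this, add_comm]
  · rintro rfl
    ext u
    simp [coeffFunctional_apply, HahnSeries.coeff_single_mul]

/-- A coefficient functional of a nonzero `g` is proportional to exactly one coefficient functional
of each functional in the monomial class of `g`. -/
theorem encard_smul_coeffFunctional_eq {ι : Type*}
    (hU : Submodule.span (LaurentSeries F) (U : Set M) = ⊤)
    (hshift : ∀ u ∈ U, ∀ s : ℤ, (HahnSeries.single s (1 : F) : LaurentSeries F) • u ∈ U)
    (c : ι → M →ₗ[LaurentSeries F] LaurentSeries F)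
    {g : M →ₗ[LaurentSeries F] LaurentSeries F} (hg : g ≠ 0) :
    {p : ι × ℤ | ∃ a : F, a • coeffFunctional U (c p.1) p.2 = coeffFunctional U g 0}.encard =
      {i | ∃ (t : ℤ) (a : F), g = (HahnSeries.single t a : LaurentSeries F) • c i}.encard := by
  simp only [smul_coeffFunctional_eq_iff hU hshift]
  have hinj : Set.InjOn Prod.fst
      {p : ι × ℤ | ∃ a : F, g = (HahnSeries.single (-p.2) a : LaurentSeries F) • c p.1} := by
    rintro ⟨i, t⟩ ⟨a, ha⟩ ⟨j, s⟩ ⟨b, hb⟩ (rfl : i = j)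
    simp only at ha hb
    have hc : c i ≠ 0 := fun h0 => hg (by rw [ha, h0, smul_zero])
    have ha0 : a ≠ 0 := fun h0 => hg (by rw [ha, h0, HahnSeries.single_eq_zero, zero_smul])
    have h : HahnSeries.single (-t) a = HahnSeries.single (-s) b :=
      smul_left_injective (LaurentSeries F) hc (ha.symm.trans hb)
    have hcoeff := congrArg (fun x => HahnSeries.coeff x (-t)) h
    simp only [HahnSeries.coeff_single_same, HahnSeries.coeff_single] at hcoeff
    split_ifs at hcoeff with hts
    · rw [neg_inj.1 hts]
    · exact absurd hcoeff ha0
  rw [← hinj.encard_image]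
  congr 1
  ext i
  constructor
  · rintro ⟨⟨i, t⟩, ⟨a, ha⟩, rfl⟩
    exact ⟨-t, a, ha⟩
  · rintro ⟨t, a, ha⟩
    exact ⟨(i, -t), ⟨a, by simpa using ha⟩, rfl⟩

/-- Proportionality by a monomial, as an equivalence relation on functionals. -/
def monomialSetoid (F M : Type*) [Field F] [AddCommGroup M] [Module (LaurentSeries F) M] :
    Setoid (M →ₗ[LaurentSeries F] LaurentSeries F) where
  r g c := ∃ (t : ℤ) (a : Fˣ), g = (HahnSeries.single t (a : F) : LaurentSeries F) • c
  iseqv :=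
    { refl := fun g => ⟨0, 1, by
        rw [Units.val_one, HahnSeries.single_zero_one, one_smul]⟩
      symm := by
        rintro g c ⟨t, a, rfl⟩
        refine ⟨-t, a⁻¹, ?_⟩
        rw [smul_smul, HahnSeries.single_mul_single, neg_add_cancel, Units.inv_mul,
          HahnSeries.single_zero_one, one_smul]
      trans := by
        rintro g c e ⟨t, a, rfl⟩ ⟨s, b, rfl⟩
        refine ⟨t + s, a * b, ?_⟩
        rw [smul_smul, HahnSeries.single_mul_single, Units.val_mul] }

/-- Two families of functionals with equal weights on a spanning shift-invariant subspace of
finite-weight vectors agree up to a permutation and monomial factors. -/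
theorem exists_perm_eq_single_smul [Finite F] {ι : Type*} [Finite ι]
    (hU : Submodule.span (LaurentSeries F) (U : Set M) = ⊤)
    (hshift : ∀ u ∈ U, ∀ s : ℤ, (HahnSeries.single s (1 : F) : LaurentSeries F) • u ∈ U)
    (c d : ι → M →ₗ[LaurentSeries F] LaurentSeries F)
    (hfin : ∀ u ∈ U, {p : ι × ℤ | (c p.1 u).coeff p.2 ≠ 0}.Finite)
    (hcd : ∀ u ∈ U, {p : ι × ℤ | (c p.1 u).coeff p.2 ≠ 0}.encard =
      {p : ι × ℤ | (d p.1 u).coeff p.2 ≠ 0}.encard) :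
    ∃ (σ : Equiv.Perm ι) (α : ι → Fˣ) (μ : ι → ℤ), ∀ i,
      d (σ i) = (HahnSeries.single (μ i) (α i : F) : LaurentSeries F) • c i := by
  classical
  have := Fintype.ofFinite ι
  have card_eq {g : M →ₗ[LaurentSeries F] LaurentSeries F} (hg : g ≠ 0) :
      {i | ∃ (t : ℤ) (a : F), g = (HahnSeries.single t a : LaurentSeries F) • c i}.encard =
      {i | ∃ (t : ℤ) (a : F), g = (HahnSeries.single t a : LaurentSeries F) • d i}.encard := by
    rw [← encard_smul_coeffFunctional_eq hU hshift c hg,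
      ← encard_smul_coeffFunctional_eq hU hshift d hg]
    refine encard_smul_eq_of_encard_ne_zero_eq (fun p : ι × ℤ => coeffFunctional U (c p.1) p.2)
      (fun p : ι × ℤ => coeffFunctional U (d p.1) p.2) (fun u => hfin u u.2) (fun u => hcd u u.2) ?_
    intro h0
    apply hg
    have := (smul_coeffFunctional_eq_iff hU hshift g g 0 0).1 (by rw [zero_smul, h0])
    rw [this, HahnSeries.single_eq_zero, zero_smul]
  have equiv_iff {g : M →ₗ[LaurentSeries F] LaurentSeries F} (hg : g ≠ 0)
      (c : M →ₗ[LaurentSeries F] LaurentSeries F) :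
      (Quotient.mk (monomialSetoid F M) c = Quotient.mk (monomialSetoid F M) g) ↔
        ∃ (t : ℤ) (a : F), g = (HahnSeries.single t a : LaurentSeries F) • c := by
    rw [eq_comm, Quotient.eq]
    constructor
    · rintro ⟨t, a, h⟩
      exact ⟨t, a, h⟩
    · rintro ⟨t, a, h⟩
      have ha : a ≠ 0 := fun h0 => hg (by rw [h, h0, HahnSeries.single_eq_zero, zero_smul])
      exact ⟨t, Units.mk0 a ha, h⟩
  have fiber {g : M →ₗ[LaurentSeries F] LaurentSeries F} (hg : g ≠ 0)
      (c : ι → M →ₗ[LaurentSeries F] LaurentSeries F) :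
      Nonempty ({i : {i // c i ≠ 0} // Quotient.mk (monomialSetoid F M) (c i) = Quotient.mk (monomialSetoid F M) g} ≃
        {i | ∃ (t : ℤ) (a : F), g = (HahnSeries.single t a : LaurentSeries F) • c i}) := by
    refine ⟨(Equiv.subtypeEquivRight fun i : {i // c i ≠ 0} => equiv_iff hg (c i)).trans
      (Equiv.subtypeSubtypeEquivSubtype (p := fun i => c i ≠ 0) (q := fun i =>
        ∃ (t : ℤ) (a : F), g = (HahnSeries.single t a : LaurentSeries F) • c i) fun {i} hi h0 => ?_)⟩
    obtain ⟨t, a, h⟩ := hi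
    exact hg (by rw [h, h0, smul_zero])
  have no_fiber (c : ι → M →ₗ[LaurentSeries F] LaurentSeries F) :
      IsEmpty {i : {i // c i ≠ 0} //
        Quotient.mk (monomialSetoid F M) (c i) = Quotient.mk (monomialSetoid F M) 0} := by
    refine ⟨fun ⟨i, hi⟩ => i.2 ?_⟩
    obtain ⟨t, a, h⟩ := Quotient.eq.1 hi
    rw [h, smul_zero]
  have key (q : Quotient (monomialSetoid F M)) :
      Nonempty ({i : {i // c i ≠ 0} // Quotient.mk (monomialSetoid F M) (c i) = q} ≃
        {i : {i // d i ≠ 0} // Quotient.mk (monomialSetoid F M) (d i) = q}) := by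
    induction q using Quotient.inductionOn with | _ g
    by_cases hg : g = 0
    · subst hg
      have := no_fiber c
      have := no_fiber d
      exact ⟨Equiv.equivOfIsEmpty _ _⟩
    · obtain ⟨e₁⟩ := fiber hg c
      obtain ⟨e₂⟩ := fiber hg d
      have h := card_eq hg
      rw [← (Set.toFinite _).cast_ncard_eq, ← (Set.toFinite _).cast_ncard_eq] at h
      obtain ⟨e⟩ := Finite.card_eq.1 (Nat.cast_injective h : Nat.card _ = Nat.card _)
      exact ⟨e₁.trans (e.trans e₂.symm)⟩
  let e := Equiv.ofFiberEquiv fun q => (key q).some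
  have hex (i : ι) : ∃ (t : ℤ) (a : Fˣ),
      d (e.extendSubtype i) = (HahnSeries.single t (a : F) : LaurentSeries F) • c i := by
    by_cases hi : c i = 0
    · refine ⟨0, 1, ?_⟩
      rw [hi, smul_zero]
      exact not_not.1 (e.extendSubtype_not_mem i (not_not.2 hi))
    · rw [e.extendSubtype_apply_of_mem i hi]
      exact Quotient.eq.1 (Equiv.ofFiberEquiv_map (fun q => (key q).some) ⟨i, hi⟩)
  choose μ α h using hex
  exact ⟨_, α, μ, h⟩

end Functionals

theorem wtL_eq_encard {n : ℕ} (v : Fin n → LaurentSeries F) :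
    wtL v = {p : Fin n × ℤ | (v p.1).coeff p.2 ≠ 0}.encard := by
  have h : {p : Fin n × ℤ | (v p.1).coeff p.2 ≠ 0} = ⋃ i, Prod.mk i '' (v i).support := by
    ext ⟨i, t⟩
    simp
  rw [h, Set.encard_iUnion_of_finite, finsum_eq_sum_of_fintype]
  · exact Finset.sum_congr rfl fun i _ => ((Prod.mk_right_injective i).encard_image _).symm
  · intro i j hij
    rw [Function.onFun, Set.disjoint_left]
    rintro _ ⟨s, _, rfl⟩ ⟨t, _, h⟩
    exact hij (congrArg Prod.fst h).symm

theorem finite_support_algebraMap_polynomial (p : Polynomial F) :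
    (algebraMap (Polynomial F) (LaurentSeries F) p).support.Finite := by
  have h : algebraMap (Polynomial F) (LaurentSeries F) p =
      HahnSeries.ofPowerSeries ℤ F (p : PowerSeries F) := rfl
  rw [h]
  refine (p.support.finite_toSet.image Nat.cast).subset fun t ht => ⟨t.natAbs, ?_, ?_⟩ <;>
    rw [HahnSeries.mem_support, PowerSeries.coeff_coe] at ht <;> split_ifs at ht with h0
  · exact absurd rfl ht
  · simpa using ht
  · exact absurd rfl ht
  · exact Int.natAbs_of_nonneg (not_lt.1 h0)

/-- **MacWilliams Extension Theorem for Laurent series convolutional codes:**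
every `R`-isometry between `R`-codes is given by a `z`-monomial matrix, and hence
extends to an `R`-isometry of `R^n`. -/
theorem stmt18 {F : Type*} [Field F] [Fintype F] {k n : ℕ}
    (C Cbar : Submodule (LaurentSeries F) (Fin n → LaurentSeries F))
    (hC : IsLSCode k C) (hCbar : IsLSCode k Cbar)
    (φ : C ≃ₗ[LaurentSeries F] Cbar)
    (hwt : ∀ v : C, wtL ((φ v : Fin n → LaurentSeries F)) = wtL (v : Fin n → LaurentSeries F)) :
    ∃ M : Matrix (Fin n) (Fin n) (LaurentSeries F), IsZMonomialLS M ∧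
      ∀ v : C, (φ v : Fin n → LaurentSeries F) = (v : Fin n → LaurentSeries F) ᵥ* M := by
    classical
  obtain ⟨G, -, hG⟩ := hC
  let U : Submodule F C :=
    { carrier := {v | {p : Fin n × ℤ | (v.1 p.1).coeff p.2 ≠ 0}.Finite}
      zero_mem' := by simp
      add_mem' := fun {v w} hv hw => (hv.union hw).subset fun p hp => by
        by_contra h
        simp only [Set.mem_union, Set.mem_ofPred_eq, not_or, not_not] at h
        exact hp (by simp [h.1, h.2])
      smul_mem' := fun a v hv => hv.subset fun p hp h => hp (by simp [h]) }
  let c : Fin n → C →ₗ[LaurentSeries F] LaurentSeries F := fun i => LinearMap.proj i ∘ₗ C.subtype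
  let d : Fin n → C →ₗ[LaurentSeries F] LaurentSeries F := fun i =>
    LinearMap.proj i ∘ₗ Cbar.subtype ∘ₗ φ.toLinearMap
  have hshift : ∀ u ∈ U, ∀ s : ℤ, (HahnSeries.single s (1 : F) : LaurentSeries F) • u ∈ U := by
    intro u hu s
    refine (hu.image fun p => (p.1, p.2 + s)).subset ?_
    rintro ⟨i, t⟩ hp
    refine ⟨(i, t - s), ?_, by simp⟩
    simpa [HahnSeries.coeff_single_mul] using hp
  have hrow (i : Fin k) : (fun j => algebraMap (Polynomial F) (LaurentSeries F) (G i j)) ∈ C := by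
    rw [← SetLike.mem_coe, hG]
    exact ⟨Pi.single i 1, by ext1 j; simp⟩
  have hrowU (i : Fin k) : (⟨_, hrow i⟩ : C) ∈ U := by
    refine (Set.finite_iUnion fun j : Fin n =>
      (finite_support_algebraMap_polynomial (G i j)).image (Prod.mk j)).subset ?_
    rintro ⟨j, t⟩ hp
    exact Set.mem_iUnion.2 ⟨j, t, hp, rfl⟩
  have hU : Submodule.span (LaurentSeries F) (U : Set C) = ⊤ := by
    refine eq_top_iff.2 fun v _ => ?_
    obtain ⟨u, hu⟩ : (v : Fin n → LaurentSeries F) ∈ codeOfLS G := hG ▸ v.2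
    have hv : v = ∑ i, u i • (⟨_, hrow i⟩ : C) := by
      ext1
      rw [← hu]
      ext1 j
      simp [Matrix.vecMul, dotProduct]
    rw [hv]
    exact Submodule.sum_mem _ fun i _ => Submodule.smul_mem _ _ (Submodule.subset_span (hrowU i))
  obtain ⟨σ, α, μ, h⟩ := exists_perm_eq_single_smul hU hshift c d (fun u hu => hu) fun u _ => by
    have := hwt u
    rw [wtL_eq_encard, wtL_eq_encard] at this
    exact this.symm
  refine ⟨fun i j => if σ i = j then
    HahnSeries.single (μ (σ.symm j)) (α (σ.symm j) : F) else 0,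
    ⟨σ, fun j => α (σ.symm j), fun j => μ (σ.symm j), fun _ _ => rfl⟩, fun v => ?_⟩
  ext1 j
  obtain ⟨i, rfl⟩ := σ.surjective j
  have hi : (φ v : Fin n → LaurentSeries F) (σ i) =
      HahnSeries.single (μ i) (α i : F) * (v : Fin n → LaurentSeries F) i :=
    DFunLike.congr_fun (h i) v
  simp only [hi, Matrix.vecMul, dotProduct]
  rw [Finset.sum_eq_single i]
  · simp [mul_comm]
  · intro l _ hl
    simp [hl]
  · simp
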